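/- Let Π be a logic program over 𝓛_𝒜 (i.e., no preference atoms occur in Π) and X a consistent set of literals. Then X is an answer set of Π if and only if X = Y ∩ 𝓛 for some answer set Y of 𝒯(Π), where 𝓛 is the language of Π viewed as an ordered program. -/

import Mathlib

set_option autoImplicit false

namespace ASP

/-- Literals over a set of atoms: an atom or its classical negation. -/
inductive Lit (α : Type) : Type
  | pos : α → Lit α
  | neg : α → Lit α

namespace Lit

/-- The atom of a literal. -/
def atom {α : Type} : Lit α → α
  | pos a => a
  | neg a => a

/-- Map a function over the atom of a literal. -/
def map {α β : Type} (f : α → β) : Lit α → Lit β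
  | pos a => pos (f a)
  | neg a => neg (f a)

end Lit

/-- A rule `head ← bodyP, not bodyN`. -/
structure Rule (α : Type) : Type where
  head : Lit α
  bodyP : Set (Lit α)
  bodyN : Set (Lit α)

/-- Map a function over the atoms of a rule. -/
def Rule.map {α β : Type} (f : α → β) (r : Rule α) : Rule β :=
  ⟨r.head.map f, Lit.map f '' r.bodyP, Lit.map f '' r.bodyN⟩

/-- The literals occurring in a rule. -/
def ruleLits {α : Type} (r : Rule α) : Set (Lit α) := insert r.head (r.bodyP ∪ r.bodyN)

/-- A set of literals is consistent iff it contains no complementary pair. -/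
def consistent {α : Type} (X : Set (Lit α)) : Prop := ¬ ∃ a, Lit.pos a ∈ X ∧ Lit.neg a ∈ X

/-- Logically closed: consistent or the set of all literals. -/
def logClosed {α : Type} (X : Set (Lit α)) : Prop := consistent X ∨ X = Set.univ

/-- The smallest logically closed set of literals containing `S`. -/
def logClosure {α : Type} (S : Set (Lit α)) : Set (Lit α) := ⋂₀ {Y | S ⊆ Y ∧ logClosed Y}

/-- `X` is closed under the (basic) program `P`. -/
def closedUnder {α : Type} (P : Set (Rule α)) (X : Set (Lit α)) : Prop :=
  ∀ r ∈ P, r.bodyP ⊆ X → r.head ∈ X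

/-- `Th P`: smallest set which is logically closed and closed under the basic program `P`. -/
def Th {α : Type} (P : Set (Rule α)) : Set (Lit α) := ⋂₀ {X | logClosed X ∧ closedUnder P X}

/-- A rule is defeated by `X` iff `bodyN r ∩ X ≠ ∅`. -/
def defeated {α : Type} (r : Rule α) (X : Set (Lit α)) : Prop := ∃ L ∈ r.bodyN, L ∈ X

/-- The Gelfond-Lifschitz reduct of `P` relative to `X`. -/
def reduct {α : Type} (P : Set (Rule α)) (X : Set (Lit α)) : Set (Rule α) :=
  {r' | ∃ r ∈ P, ¬ defeated r X ∧ r' = Rule.mk r.head r.bodyP ∅}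

/-- `X` is an answer set of `P` iff `Th (P^X) = X`. -/
def answerSet {α : Type} (P : Set (Rule α)) (X : Set (Lit α)) : Prop := Th (reduct P X) = X

/-- Generating rules of `X` from `P`. -/
def GR {α : Type} (P : Set (Rule α)) (X : Set (Lit α)) : Set (Rule α) :=
  {r | r ∈ P ∧ r.bodyP ⊆ X ∧ ¬ defeated r X}

/-- Heads of the rules occurring before position `i` in the list `l`. -/
def headsBefore {α : Type} (l : List (Rule α)) (i : ℕ) : Set (Lit α) :=
  {L | L ∈ (l.take i).map Rule.head}

/-- The sequence of rules `l` is grounded. -/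
def groundedList {α : Type} (l : List (Rule α)) : Prop :=
  ∀ (i : ℕ) (h : i < l.length),
    consistent (headsBefore l i) → (l.get ⟨i, h⟩).bodyP ⊆ headsBefore l i

/-- `l` is an enumeration of the set `S` of rules. -/
def enumerates {α : Type} (l : List (Rule α)) (S : Set (Rule α)) : Prop :=
  l.Nodup ∧ {r | r ∈ l} = S

/-- The one-step consequence operator for basic programs. -/
def TOp {α : Type} (P : Set (Rule α)) (X : Set (Lit α)) : Set (Lit α) :=
  {L | (consistent X ∧ ∃ r ∈ P, r.bodyP ⊆ X ∧ r.head = L) ∨ ¬ consistent X}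

/-- Iterated application of `TOp`, starting from `∅`. -/
def TIter {α : Type} (P : Set (Rule α)) : ℕ → Set (Lit α)
  | 0 => ∅
  | n + 1 => TOp P (TIter P n)

/-- A strict partial order whose field is contained in `P`. -/
def strictOn {γ : Type} (P : Set γ) (lt : γ → γ → Prop) : Prop :=
  (∀ a b, lt a b → a ∈ P ∧ b ∈ P) ∧ (∀ a b c, lt a b → lt b c → lt a c) ∧ (∀ a, ¬ lt a a)

/-- A total strict order on `P`. -/
def totalStrictOn {γ : Type} (P : Set γ) (ll : γ → γ → Prop) : Prop :=
  (∀ a b, ll a b → a ∈ P ∧ b ∈ P) ∧ (∀ a b c, ll a b → ll b c → ll a c) ∧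
    (∀ a, ¬ ll a a) ∧ (∀ a ∈ P, ∀ b ∈ P, a ≠ b → ll a b ∨ ll b a)

/-! ## Ordered logic programs -/

/-- Atoms of the language of an ordered logic program: regular atoms and
preference atoms `n ≺ m` over names. -/
inductive OAtom (α N : Type) : Type
  | reg : α → OAtom α N
  | pref : N → N → OAtom α N

/-- Rules of an ordered logic program. -/
abbrev ORule (α N : Type) := Rule (OAtom α N)

/-- The preference literal `(n ≺ m)`. -/
def prefLit {α N : Type} (n m : N) : Lit (OAtom α N) := Lit.pos (OAtom.pref n m)

/-- A literal over a regular atom. -/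
def regLitO {α N : Type} (L : Lit (OAtom α N)) : Prop := ∃ a, L.atom = OAtom.reg a

/-- No preference atom occurs in the rule `r`. -/
def noPref {α N : Type} (r : ORule α N) : Prop := ∀ L ∈ ruleLits r, regLitO L

/-- The dynamically induced preference `r <_X r'`, at the level of the language `𝓛`. -/
def precXO {α N : Type} (nm : ORule α N → N) (X : Set (Lit (OAtom α N)))
    (r s : ORule α N) : Prop :=
  prefLit (nm r) (nm s) ∈ X

/-- The fact `(n_r ≺ n_s) ←`. -/
def prefFactO {α N : Type} (nm : ORule α N → N) (r s : ORule α N) : ORule α N :=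
  ⟨prefLit (nm r) (nm s), ∅, ∅⟩

/-- The transitivity rule `t(r,s,t)`. -/
def tRuleO {α N : Type} (nm : ORule α N → N) (r s t : ORule α N) : ORule α N :=
  ⟨prefLit (nm r) (nm t), {prefLit (nm r) (nm s), prefLit (nm s) (nm t)}, ∅⟩

/-- The antisymmetry rule `as(r,s)`. -/
def asRuleO {α N : Type} (nm : ORule α N → N) (r s : ORule α N) : ORule α N :=
  ⟨Lit.neg (OAtom.pref (nm s) (nm r)), {prefLit (nm r) (nm s)}, ∅⟩

/-- `TA(Π)`: `Π` together with all transitivity and antisymmetry rules. -/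
def TA {α N : Type} (P : Set (ORule α N)) (nm : ORule α N → N) : Set (ORule α N) :=
  P ∪ {ru | ∃ r ∈ P, ∃ s ∈ P, ∃ t ∈ P, ru = tRuleO nm r s t}
    ∪ {ru | ∃ r ∈ P, ∃ s ∈ P, ru = asRuleO nm r s}

/-- The statically ordered program `(Π,<)`, identified with
`Π ∪ {(n_r ≺ n_{r'}) ← ∣ r < r'}`. -/
def staticProg {α N : Type} (P : Set (ORule α N)) (nm : ORule α N → N)
    (lt : ORule α N → ORule α N → Prop) : Set (ORule α N) :=
  P ∪ {ru | ∃ r ∈ P, ∃ s ∈ P, lt r s ∧ ru = prefFactO nm r s}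

/-- The heads of the generating rules occurring before position `i` in `l`. -/
def grHeadsBefore {α : Type} (l : List (Rule α)) (G : Set (Rule α)) (i : ℕ) :
    Set (Lit α) :=
  {L | ∃ j, ∃ h : j < l.length, j < i ∧ l.get ⟨j, h⟩ ∈ G ∧ (l.get ⟨j, h⟩).head = L}

/-- `X` is a `<`-preserving answer set of the statically ordered program `(P,lt)`
(Definition 1). -/
def staticPreserving {α N : Type} (P : Set (ORule α N))
    (lt : ORule α N → ORule α N → Prop) (X : Set (Lit (OAtom α N))) : Prop :=
  answerSet P X ∧ consistent X ∧
    ∃ l : List (ORule α N), enumerates l (GR P X) ∧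
      (∀ (i : ℕ) (h : i < l.length), (l.get ⟨i, h⟩).bodyP ⊆ headsBefore l i) ∧
      (∀ (i j : ℕ) (hi : i < l.length) (hj : j < l.length),
        lt (l.get ⟨i, hi⟩) (l.get ⟨j, hj⟩) → j < i) ∧
      (∀ (i : ℕ) (hi : i < l.length), ∀ r' ∈ P, r' ∉ GR P X →
        lt (l.get ⟨i, hi⟩) r' →
          ¬ r'.bodyP ⊆ X ∨ ∃ L ∈ r'.bodyN, L ∈ headsBefore l i)

/-- `X` is a `<_X`-preserving answer set of the program `P` (standing for `TA(Π)`;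
Definition 3). -/
def dynPreserving {α N : Type} (nm : ORule α N → N) (P : Set (ORule α N))
    (X : Set (Lit (OAtom α N))) : Prop :=
  answerSet P X ∧ consistent X ∧
    ∃ l : List (ORule α N), enumerates l P ∧
      (∀ (i j : ℕ) (hi : i < l.length) (hj : j < l.length),
        precXO nm X (l.get ⟨i, hi⟩) (l.get ⟨j, hj⟩) → j < i) ∧
      (∀ (i j : ℕ) (hi : i < l.length) (hj : j < l.length),
        precXO nm X (l.get ⟨i, hi⟩) (l.get ⟨j, hj⟩) →
          ∃ k, ∃ hk : k < l.length, k < i ∧ l.get ⟨k, hk⟩ ∈ GR P X ∧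
            (l.get ⟨k, hk⟩).head = prefLit (nm (l.get ⟨i, hi⟩)) (nm (l.get ⟨j, hj⟩))) ∧
      (∀ (i : ℕ) (hi : i < l.length), l.get ⟨i, hi⟩ ∈ GR P X →
        (l.get ⟨i, hi⟩).bodyP ⊆ grHeadsBefore l (GR P X) i) ∧
      (∀ (i : ℕ) (hi : i < l.length), l.get ⟨i, hi⟩ ∉ GR P X →
        ¬ (l.get ⟨i, hi⟩).bodyP ⊆ X ∨
          ∃ L ∈ (l.get ⟨i, hi⟩).bodyN, L ∈ grHeadsBefore l (GR P X) i)

/-- Occurrence of a name in a rule (inside some preference atom). -/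
def nameOccurs {α N : Type} (n : N) (r : ORule α N) : Prop :=
  ∃ L ∈ ruleLits r, ∃ m, L.atom = OAtom.pref n m ∨ L.atom = OAtom.pref m n

/-! ## The translation 𝒯 -/

/-- Atoms of the target language `𝓛⁺` of the translation `𝒯`. -/
inductive TAtom (α N : Type) : Type
  | old : OAtom α N → TAtom α N
  | ap : N → TAtom α N
  | bl : N → TAtom α N
  | ok : N → TAtom α N
  | rdy : N → N → TAtom α N

/-- Embedding of `𝓛`-literals into `𝓛⁺`. -/
def oldLit {α N : Type} (L : Lit (OAtom α N)) : Lit (TAtom α N) := L.map TAtom.old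

/-- The preference literal `(n ≺ m)` inside `𝓛⁺`. -/
def tpref {α N : Type} (n m : N) : Lit (TAtom α N) := Lit.pos (TAtom.old (OAtom.pref n m))

def apLit {α N : Type} (n : N) : Lit (TAtom α N) := Lit.pos (TAtom.ap n)
def blLit {α N : Type} (n : N) : Lit (TAtom α N) := Lit.pos (TAtom.bl n)
def okLit {α N : Type} (n : N) : Lit (TAtom α N) := Lit.pos (TAtom.ok n)
def rdyLit {α N : Type} (n m : N) : Lit (TAtom α N) := Lit.pos (TAtom.rdy n m)

/-- `a1(r) : head(r) ← ap(n_r)`. -/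
def a1Rule {α N : Type} (nm : ORule α N → N) (r : ORule α N) : Rule (TAtom α N) :=
  ⟨oldLit r.head, {apLit (nm r)}, ∅⟩

/-- `a2(r) : ap(n_r) ← ok(n_r), body(r)`. -/
def a2Rule {α N : Type} (nm : ORule α N → N) (r : ORule α N) : Rule (TAtom α N) :=
  ⟨apLit (nm r), insert (okLit (nm r)) (oldLit '' r.bodyP), oldLit '' r.bodyN⟩

/-- `b1(r,L⁺) : bl(n_r) ← ok(n_r), not L⁺`. -/
def b1Rule {α N : Type} (nm : ORule α N → N) (r : ORule α N) (L : Lit (OAtom α N)) :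
    Rule (TAtom α N) :=
  ⟨blLit (nm r), {okLit (nm r)}, {oldLit L}⟩

/-- `b2(r,L⁻) : bl(n_r) ← ok(n_r), L⁻`. -/
def b2Rule {α N : Type} (nm : ORule α N → N) (r : ORule α N) (L : Lit (OAtom α N)) :
    Rule (TAtom α N) :=
  ⟨blLit (nm r), {okLit (nm r), oldLit L}, ∅⟩

/-- `c1(r) : ok(n_r) ← rdy(n_r,n_{r_1}), …, rdy(n_r,n_{r_k})`. -/
def c1Rule {α N : Type} (P : Set (ORule α N)) (nm : ORule α N → N) (r : ORule α N) :
    Rule (TAtom α N) :=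
  ⟨okLit (nm r), {L | ∃ s ∈ P, L = rdyLit (nm r) (nm s)}, ∅⟩

/-- `c2(r,s) : rdy(n_r,n_s) ← not (n_r ≺ n_s)`. -/
def c2Rule {α N : Type} (nm : ORule α N → N) (r s : ORule α N) : Rule (TAtom α N) :=
  ⟨rdyLit (nm r) (nm s), ∅, {tpref (nm r) (nm s)}⟩

/-- `c3(r,s) : rdy(n_r,n_s) ← (n_r ≺ n_s), ap(n_s)`. -/
def c3Rule {α N : Type} (nm : ORule α N → N) (r s : ORule α N) : Rule (TAtom α N) :=
  ⟨rdyLit (nm r) (nm s), {tpref (nm r) (nm s), apLit (nm s)}, ∅⟩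

/-- `c4(r,s) : rdy(n_r,n_s) ← (n_r ≺ n_s), bl(n_s)`. -/
def c4Rule {α N : Type} (nm : ORule α N → N) (r s : ORule α N) : Rule (TAtom α N) :=
  ⟨rdyLit (nm r) (nm s), {tpref (nm r) (nm s), blLit (nm s)}, ∅⟩

/-- `t(r,s,t) : (n_r ≺ n_t) ← (n_r ≺ n_s), (n_s ≺ n_t)` inside `𝓛⁺`. -/
def tRuleT {α N : Type} (nm : ORule α N → N) (r s t : ORule α N) : Rule (TAtom α N) :=
  ⟨tpref (nm r) (nm t), {tpref (nm r) (nm s), tpref (nm s) (nm t)}, ∅⟩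

/-- `as(r,s) : ¬(n_s ≺ n_r) ← (n_r ≺ n_s)` inside `𝓛⁺`. -/
def asRuleT {α N : Type} (nm : ORule α N → N) (r s : ORule α N) : Rule (TAtom α N) :=
  ⟨Lit.neg (TAtom.old (OAtom.pref (nm s) (nm r))), {tpref (nm r) (nm s)}, ∅⟩

/-- The set of rules `τ(r)` of Definition 2. -/
def tau {α N : Type} (P : Set (ORule α N)) (nm : ORule α N → N) (r : ORule α N) :
    Set (Rule (TAtom α N)) :=
  {a1Rule nm r, a2Rule nm r, c1Rule P nm r}
    ∪ {ru | ∃ L ∈ r.bodyP, ru = b1Rule nm r L}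
    ∪ {ru | ∃ L ∈ r.bodyN, ru = b2Rule nm r L}
    ∪ {ru | ∃ s ∈ P, ru = c2Rule nm r s ∨ ru = c3Rule nm r s ∨ ru = c4Rule nm r s}
    ∪ {ru | ∃ s ∈ P, ∃ t ∈ P, ru = tRuleT nm r s t}
    ∪ {ru | ∃ s ∈ P, ru = asRuleT nm r s}

/-- The translation `𝒯(Π) = ⋃_{r ∈ Π} τ(r)`. -/
def TTrans {α N : Type} (P : Set (ORule α N)) (nm : ORule α N → N) :
    Set (Rule (TAtom α N)) :=
  {ru | ∃ r ∈ P, ru ∈ tau P nm r}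

/-- `𝒯(Π,<)` for a statically ordered program. -/
def TStatic {α N : Type} (P : Set (ORule α N)) (nm : ORule α N → N)
    (lt : ORule α N → ORule α N → Prop) : Set (Rule (TAtom α N)) :=
  TTrans (staticProg P nm lt) nm

/-- The dynamically induced preference `r <_X r'` read off from an answer set of
the translated program. -/
def precX {α N : Type} (nm : ORule α N → N) (X : Set (Lit (TAtom α N)))
    (r s : ORule α N) : Prop :=
  tpref (nm r) (nm s) ∈ X

/-- The literals of `𝓛⁺` over regular atoms (the set `𝓛_𝒜`). -/
def regLitsT {α N : Type} : Set (Lit (TAtom α N)) :=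
  {L | ∃ a, L.atom = TAtom.old (OAtom.reg a)}

/-- The literals of `𝓛⁺` belonging to the original language `𝓛`. -/
def oldLitsT {α N : Type} : Set (Lit (TAtom α N)) := Set.range oldLit

/-- A rule of `𝒯(Π)` that is an "image" of `r ∈ Π`:
`a2(r)`, or `b1(r,L)`/`b2(r,L)` for some body literal `L` of `r`. -/
def imgRule {α N : Type} (nm : ORule α N → N) (r : ORule α N)
    (ru : Rule (TAtom α N)) : Prop :=
  ru = a2Rule nm r ∨ (∃ L ∈ r.bodyP, ru = b1Rule nm r L) ∨
    (∃ L ∈ r.bodyN, ru = b2Rule nm r L)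

/-! ## The translation 𝒰 (Brewka–Eiter encoding) -/

/-- Atoms of the target language `𝓛°` of the translation `𝒰`. -/
inductive UAtom (α N : Type) : Type
  | old : OAtom α N → UAtom α N
  | pr : OAtom α N → UAtom α N
  | ap : N → UAtom α N
  | bl : N → UAtom α N
  | ok : N → UAtom α N
  | rdy : N → N → UAtom α N
  | de : N → UAtom α N

def uold {α N : Type} (L : Lit (OAtom α N)) : Lit (UAtom α N) := L.map UAtom.old
def uprimed {α N : Type} (L : Lit (OAtom α N)) : Lit (UAtom α N) := L.map UAtom.pr
def upref {α N : Type} (n m : N) : Lit (UAtom α N) := Lit.pos (UAtom.old (OAtom.pref n m))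
def uapLit {α N : Type} (n : N) : Lit (UAtom α N) := Lit.pos (UAtom.ap n)
def ublLit {α N : Type} (n : N) : Lit (UAtom α N) := Lit.pos (UAtom.bl n)
def uokLit {α N : Type} (n : N) : Lit (UAtom α N) := Lit.pos (UAtom.ok n)
def urdyLit {α N : Type} (n m : N) : Lit (UAtom α N) := Lit.pos (UAtom.rdy n m)
def udeLit {α N : Type} (n : N) : Lit (UAtom α N) := Lit.pos (UAtom.de n)

/-- `a1(r) : head(r') ← ap(n_r)`. -/
def ua1 {α N : Type} (nm : ORule α N → N) (r : ORule α N) : Rule (UAtom α N) :=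
  ⟨uprimed r.head, {uapLit (nm r)}, ∅⟩

/-- `a2(r) : ap(n_r) ← ok(n_r), body(r), not body⁻(r')`. -/
def ua2 {α N : Type} (nm : ORule α N → N) (r : ORule α N) : Rule (UAtom α N) :=
  ⟨uapLit (nm r), insert (uokLit (nm r)) (uold '' r.bodyP),
    uold '' r.bodyN ∪ uprimed '' r.bodyN⟩

/-- `b1(r,L) : bl(n_r) ← ok(n_r), not L, not L'`. -/
def ub1 {α N : Type} (nm : ORule α N → N) (r : ORule α N) (L : Lit (OAtom α N)) :
    Rule (UAtom α N) :=
  ⟨ublLit (nm r), {uokLit (nm r)}, {uold L, uprimed L}⟩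

/-- `b2(r,K) : bl(n_r) ← ok(n_r), K, K'`. -/
def ub2 {α N : Type} (nm : ORule α N → N) (r : ORule α N) (K : Lit (OAtom α N)) :
    Rule (UAtom α N) :=
  ⟨ublLit (nm r), {uokLit (nm r), uold K, uprimed K}, ∅⟩

/-- `c1(r) : ok(n_r) ← rdy(n_r,n_{r_1}), …, rdy(n_r,n_{r_k})`. -/
def uc1 {α N : Type} (P : Set (ORule α N)) (nm : ORule α N → N) (r : ORule α N) :
    Rule (UAtom α N) :=
  ⟨uokLit (nm r), {L | ∃ s ∈ P, L = urdyLit (nm r) (nm s)}, ∅⟩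

/-- `c2(r,s) : rdy(n_r,n_s) ← not (n_r ≺ n_s)`. -/
def uc2 {α N : Type} (nm : ORule α N → N) (r s : ORule α N) : Rule (UAtom α N) :=
  ⟨urdyLit (nm r) (nm s), ∅, {upref (nm r) (nm s)}⟩

/-- `c3(r,s) : rdy(n_r,n_s) ← (n_r ≺ n_s), ap(n_s)`. -/
def uc3 {α N : Type} (nm : ORule α N → N) (r s : ORule α N) : Rule (UAtom α N) :=
  ⟨urdyLit (nm r) (nm s), {upref (nm r) (nm s), uapLit (nm s)}, ∅⟩

/-- `c4(r,s) : rdy(n_r,n_s) ← (n_r ≺ n_s), bl(n_s)`. -/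
def uc4 {α N : Type} (nm : ORule α N → N) (r s : ORule α N) : Rule (UAtom α N) :=
  ⟨urdyLit (nm r) (nm s), {upref (nm r) (nm s), ublLit (nm s)}, ∅⟩

/-- `c5(r,s,J) : rdy(n_r,n_s) ← head(s), J`. -/
def uc5 {α N : Type} (nm : ORule α N → N) (r s : ORule α N) (J : Lit (OAtom α N)) :
    Rule (UAtom α N) :=
  ⟨urdyLit (nm r) (nm s), {uold s.head, uold J}, ∅⟩

/-- The constraint `de(r) : ← not ok(n_r)`, rendered as
`p_r ← not ok(n_r), not p_r` for the fresh atom `p_r = de(n_r)`. -/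
def ude {α N : Type} (nm : ORule α N → N) (r : ORule α N) : Rule (UAtom α N) :=
  ⟨udeLit (nm r), ∅, {uokLit (nm r), udeLit (nm r)}⟩

/-- Transitivity rule inside `𝓛°`. -/
def utr {α N : Type} (nm : ORule α N → N) (r s t : ORule α N) : Rule (UAtom α N) :=
  ⟨upref (nm r) (nm t), {upref (nm r) (nm s), upref (nm s) (nm t)}, ∅⟩

/-- Antisymmetry rule inside `𝓛°`. -/
def uas {α N : Type} (nm : ORule α N → N) (r s : ORule α N) : Rule (UAtom α N) :=
  ⟨Lit.neg (UAtom.old (OAtom.pref (nm s) (nm r))), {upref (nm r) (nm s)}, ∅⟩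

/-- The set of rules `τ(r)` of Definition 8. -/
def utau {α N : Type} (P : Set (ORule α N)) (nm : ORule α N → N) (r : ORule α N) :
    Set (Rule (UAtom α N)) :=
  {ua1 nm r, ua2 nm r, uc1 P nm r, ude nm r}
    ∪ {ru | ∃ L ∈ r.bodyP, ru = ub1 nm r L}
    ∪ {ru | ∃ K ∈ r.bodyN, ru = ub2 nm r K}
    ∪ {ru | ∃ s ∈ P, ru = uc2 nm r s ∨ ru = uc3 nm r s ∨ ru = uc4 nm r s}
    ∪ {ru | ∃ s ∈ P, ∃ J ∈ s.bodyN, ru = uc5 nm r s J}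
    ∪ {ru | ∃ s ∈ P, ∃ t ∈ P, ru = utr nm r s t}
    ∪ {ru | ∃ s ∈ P, ru = uas nm r s}

/-- The translation `𝒰(Π) = Π ∪ ⋃_{r ∈ Π} τ(r)`. -/
def UTrans {α N : Type} (P : Set (ORule α N)) (nm : ORule α N → N) :
    Set (Rule (UAtom α N)) :=
  (Rule.map UAtom.old) '' P ∪ {ru | ∃ r ∈ P, ru ∈ utau P nm r}

/-- The fact `(n_r ≺ n_s) ←` inside `𝓛°`. -/
def uPrefFact {α N : Type} (nm : ORule α N → N) (r s : ORule α N) : Rule (UAtom α N) :=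
  ⟨upref (nm r) (nm s), ∅, ∅⟩

/-- The literals of `𝓛°` over regular atoms (the set `𝓛_𝒜`). -/
def regLitsU {α N : Type} : Set (Lit (UAtom α N)) :=
  {L | ∃ a, L.atom = UAtom.old (OAtom.reg a)}

/-! ## Brewka–Eiter preferred answer sets -/

/-- `reductBE r = head(r) ← not body⁻(r)`. -/
def reductBE {γ : Type} (r : Rule γ) : Rule γ := ⟨r.head, ∅, r.bodyN⟩

/-- The sequence `X_i` of Definition 5 (for the enumeration `l` and the set `X`). -/
def CSeq {γ : Type} (l : List (Rule γ)) (X : Set (Lit γ)) : ℕ → Set (Lit γ)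
  | 0 => ∅
  | i + 1 =>
    CSeq l X i ∪
      {L | ∃ h : i < l.length,
        ¬ defeated (l.get ⟨i, h⟩) (CSeq l X i) ∧
        ¬ ((l.get ⟨i, h⟩).head ∈ X ∧ defeated (l.get ⟨i, h⟩) X) ∧
        L = (l.get ⟨i, h⟩).head}

/-- The operator `C` of Definition 5. -/
def COp {γ : Type} (l : List (Rule γ)) (X : Set (Lit γ)) : Set (Lit γ) :=
  logClosure (⋃ i, CSeq l X i)

/-- `l` is the enumeration of `P` according to the total order `ll`
(most preferred rule first). -/
def descList {γ : Type} (l : List (Rule γ)) (P : Set (Rule γ))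
    (ll : Rule γ → Rule γ → Prop) : Prop :=
  enumerates l P ∧
    ∀ (i j : ℕ) (hi : i < l.length) (hj : j < l.length), i < j →
      ll (l.get ⟨j, hj⟩) (l.get ⟨i, hi⟩)

/-- `X` is the BE-preferred answer set of the fully ordered prerequisite-free
program `(P,ll)`. -/
def BEPrefPF {γ : Type} (P : Set (Rule γ)) (ll : Rule γ → Rule γ → Prop)
    (X : Set (Lit γ)) : Prop :=
  ∃ l, descList l P ll ∧ COp l X = X

/-- The program `Π_X` of Definition 7. -/
def PiX {γ : Type} (P : Set (Rule γ)) (X : Set (Lit γ)) : Set (Rule γ) :=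
  {r' | ∃ r ∈ P, r.bodyP ⊆ X ∧ r' = reductBE r}

/-- `r` is the `ll`-maximal rule of `P` whose BE-reduct is `a`. -/
def beMax {γ : Type} (P : Set (Rule γ)) (ll : Rule γ → Rule γ → Prop)
    (a r : Rule γ) : Prop :=
  r ∈ P ∧ reductBE r = a ∧ ∀ s ∈ P, reductBE s = a → s = r ∨ ll s r

/-- The inherited order `ll_X` of Definition 7. -/
def llX {γ : Type} (P : Set (Rule γ)) (ll : Rule γ → Rule γ → Prop)
    (a b : Rule γ) : Prop :=
  ∃ r1 r2, beMax P ll a r1 ∧ beMax P ll b r2 ∧ ll r1 r2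

/-- `X` is a BE-preferred answer set of the fully ordered program `(P,ll)`. -/
def BEPrefFull {γ : Type} (P : Set (Rule γ)) (ll : Rule γ → Rule γ → Prop)
    (X : Set (Lit γ)) : Prop :=
  answerSet P X ∧ BEPrefPF (PiX P X) (llX P ll) X

/-- `X` is a BE-preferred answer set of the statically ordered program `(P,lt)`. -/
def BEPreferred {γ : Type} (P : Set (Rule γ)) (lt : Rule γ → Rule γ → Prop)
    (X : Set (Lit γ)) : Prop :=
  ∃ ll, totalStrictOn P ll ∧ (∀ a b, lt a b → ll a b) ∧ BEPrefFull P ll X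


theorem oldLit_injective {α N : Type} :
    Function.Injective (oldLit : Lit (OAtom α N) → Lit (TAtom α N)) := by
  rintro (a | a) (b | b) h <;> simp_all [oldLit, Lit.map]

theorem consistent.mono {α : Type} {X Y : Set (Lit α)} (hY : consistent Y) (h : X ⊆ Y) :
    consistent X :=
  fun ⟨a, hp, hn⟩ => hY ⟨a, h hp, h hn⟩

theorem logClosed_Th {α : Type} (P : Set (Rule α)) : logClosed (Th P) := by
  by_cases h : ∃ X, consistent X ∧ closedUnder P X
  · obtain ⟨X, hX, hc⟩ := h
    exact Or.inl (hX.mono (Set.sInter_subset_of_mem ⟨Or.inl hX, hc⟩))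
  · refine Or.inr (Set.sInter_eq_univ.2 ?_)
    rintro X ⟨hX | hX, hc⟩
    · exact (h ⟨X, hX, hc⟩).elim
    · exact hX

theorem closedUnder_Th {α : Type} (P : Set (Rule α)) : closedUnder P (Th P) :=
  fun r hr hb _ hX => hX.2 r hr (hb.trans (Set.sInter_subset_of_mem hX))

theorem Th_subset {α : Type} {P : Set (Rule α)} {X : Set (Lit α)} (hX : logClosed X)
    (hc : closedUnder P X) : Th P ⊆ X :=
  Set.sInter_subset_of_mem ⟨hX, hc⟩

theorem closedUnder_reduct_iff {α : Type} {P : Set (Rule α)} {X Z : Set (Lit α)} :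
    closedUnder (reduct P X) Z ↔
      ∀ r ∈ P, (∀ L ∈ r.bodyN, L ∉ X) → r.bodyP ⊆ Z → r.head ∈ Z := by
  constructor
  · intro h r hr hd hb
    exact h ⟨r.head, r.bodyP, ∅⟩ ⟨r, hr, fun ⟨L, hL, hLX⟩ => hd L hL hLX, rfl⟩ hb
  · rintro h _ ⟨r, hr, hd, rfl⟩ hb
    exact h r hr (fun L hL hLX => hd ⟨L, hL, hLX⟩) hb

/-- An answer set is contained in every subset of it that is closed under the reduct,
provided the answer set is consistent. -/
theorem answerSet.subset_of_closedUnder {α : Type} {P : Set (Rule α)} {X Z : Set (Lit α)}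
    (h : answerSet P X) (hX : consistent X) (hZ : Z ⊆ X) (hc : closedUnder (reduct P X) Z) :
    X ⊆ Z :=
  h.symm.subset.trans (Th_subset (Or.inl (hX.mono hZ)) hc)

theorem answerSet.closedUnder_reduct {α : Type} {P : Set (Rule α)} {X : Set (Lit α)}
    (h : answerSet P X) : closedUnder (reduct P X) X := by
  have hc := closedUnder_Th (reduct P X)
  rwa [show Th (reduct P X) = X from h] at hc

theorem answerSet.logClosed {α : Type} {P : Set (Rule α)} {X : Set (Lit α)}
    (h : answerSet P X) : logClosed X := by
  have hc := logClosed_Th (reduct P X)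
  rwa [show Th (reduct P X) = X from h] at hc

/-- `Z` satisfies the rules of the reduct of `𝒯(Π)` relative to `Y`, rule by rule. -/
structure TClosed {α N : Type} (P : Set (ORule α N)) (nm : ORule α N → N)
    (Y Z : Set (Lit (TAtom α N))) : Prop where
  a1 : ∀ r ∈ P, apLit (nm r) ∈ Z → oldLit r.head ∈ Z
  a2 : ∀ r ∈ P, (∀ L ∈ r.bodyN, oldLit L ∉ Y) → okLit (nm r) ∈ Z →
    (∀ L ∈ r.bodyP, oldLit L ∈ Z) → apLit (nm r) ∈ Z
  b1 : ∀ r ∈ P, ∀ L ∈ r.bodyP, oldLit L ∉ Y → okLit (nm r) ∈ Z → blLit (nm r) ∈ Z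
  b2 : ∀ r ∈ P, ∀ L ∈ r.bodyN, okLit (nm r) ∈ Z → oldLit L ∈ Z → blLit (nm r) ∈ Z
  c1 : ∀ r ∈ P, (∀ s ∈ P, rdyLit (nm r) (nm s) ∈ Z) → okLit (nm r) ∈ Z
  c2 : ∀ r ∈ P, ∀ s ∈ P, tpref (nm r) (nm s) ∉ Y → rdyLit (nm r) (nm s) ∈ Z
  c3 : ∀ r ∈ P, ∀ s ∈ P, tpref (nm r) (nm s) ∈ Z → apLit (nm s) ∈ Z →
    rdyLit (nm r) (nm s) ∈ Z
  c4 : ∀ r ∈ P, ∀ s ∈ P, tpref (nm r) (nm s) ∈ Z → blLit (nm s) ∈ Z →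
    rdyLit (nm r) (nm s) ∈ Z
  t : ∀ r ∈ P, ∀ s ∈ P, ∀ u ∈ P, tpref (nm r) (nm s) ∈ Z → tpref (nm s) (nm u) ∈ Z →
    tpref (nm r) (nm u) ∈ Z
  as : ∀ r ∈ P, ∀ s ∈ P, tpref (nm r) (nm s) ∈ Z →
    Lit.neg (TAtom.old (OAtom.pref (nm s) (nm r))) ∈ Z

theorem closedUnder_reduct_TTrans_iff {α N : Type} {P : Set (ORule α N)} {nm : ORule α N → N}
    {Y Z : Set (Lit (TAtom α N))} :
    closedUnder (reduct (TTrans P nm) Y) Z ↔ TClosed P nm Y Z := by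
  rw [closedUnder_reduct_iff]
  constructor
  · intro h
    constructor
    · intro r hr h1
      exact h (a1Rule nm r) ⟨r, hr, by simp [tau]⟩ (by simp [a1Rule]) (by simpa [a1Rule] using h1)
    · intro r hr h1 h2 h3
      refine h (a2Rule nm r) ⟨r, hr, by simp [tau]⟩ (by simpa [a2Rule] using h1) ?_
      simpa [a2Rule, Set.insert_subset_iff, Set.subset_def] using ⟨h2, h3⟩
    · intro r hr L hL h1 h2
      refine h (b1Rule nm r L) ⟨r, hr, ?_⟩ (by simpa [b1Rule] using h1) (by simpa [b1Rule] using h2)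
      simp only [tau, Set.mem_union, Set.mem_ofPred_eq]
      exact Or.inl (Or.inl (Or.inl (Or.inl (Or.inr ⟨L, hL, rfl⟩))))
    · intro r hr L hL h1 h2
      refine h (b2Rule nm r L) ⟨r, hr, ?_⟩ (by simp [b2Rule])
        (by simpa [b2Rule, Set.insert_subset_iff] using ⟨h1, h2⟩)
      simp only [tau, Set.mem_union, Set.mem_ofPred_eq]
      exact Or.inl (Or.inl (Or.inl (Or.inr ⟨L, hL, rfl⟩)))
    · intro r hr h1
      refine h (c1Rule P nm r) ⟨r, hr, by simp [tau]⟩ (by simp [c1Rule]) ?_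
      rintro _ ⟨s, hs, rfl⟩
      exact h1 s hs
    · intro r hr s hs h1
      refine h (c2Rule nm r s) ⟨r, hr, ?_⟩ (by simpa [c2Rule] using h1) (by simp [c2Rule])
      simp only [tau, Set.mem_union, Set.mem_ofPred_eq]
      exact Or.inl (Or.inl (Or.inr ⟨s, hs, Or.inl rfl⟩))
    · intro r hr s hs h1 h2
      refine h (c3Rule nm r s) ⟨r, hr, ?_⟩ (by simp [c3Rule])
        (by simpa [c3Rule, Set.insert_subset_iff] using ⟨h1, h2⟩)
      simp only [tau, Set.mem_union, Set.mem_ofPred_eq]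
      exact Or.inl (Or.inl (Or.inr ⟨s, hs, Or.inr (Or.inl rfl)⟩))
    · intro r hr s hs h1 h2
      refine h (c4Rule nm r s) ⟨r, hr, ?_⟩ (by simp [c4Rule])
        (by simpa [c4Rule, Set.insert_subset_iff] using ⟨h1, h2⟩)
      simp only [tau, Set.mem_union, Set.mem_ofPred_eq]
      exact Or.inl (Or.inl (Or.inr ⟨s, hs, Or.inr (Or.inr rfl)⟩))
    · intro r hr s hs u hu h1 h2
      refine h (tRuleT nm r s u) ⟨r, hr, ?_⟩ (by simp [tRuleT])
        (by simpa [tRuleT, Set.insert_subset_iff] using ⟨h1, h2⟩)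
      simp only [tau, Set.mem_union, Set.mem_ofPred_eq]
      exact Or.inl (Or.inr ⟨s, hs, u, hu, rfl⟩)
    · intro r hr s hs h1
      refine h (asRuleT nm r s) ⟨r, hr, ?_⟩ (by simp [asRuleT]) (by simpa [asRuleT] using h1)
      simp only [tau, Set.mem_union, Set.mem_ofPred_eq]
      exact Or.inr ⟨s, hs, rfl⟩
  · rintro h ru ⟨r, hr, hru⟩ hN hP
    simp only [tau, Set.mem_union, Set.mem_ofPred_eq, Set.mem_insert_iff,
      Set.mem_singleton_iff] at hru
    obtain (((((rfl | rfl | rfl) | ⟨L, hL, rfl⟩) | ⟨L, hL, rfl⟩) |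
      ⟨s, hs, rfl | rfl | rfl⟩) | ⟨s, hs, u, hu, rfl⟩) | ⟨s, hs, rfl⟩ := hru
    · exact h.a1 r hr (hP rfl)
    · exact h.a2 r hr (fun L hL => hN _ ⟨L, hL, rfl⟩) (hP (Or.inl rfl))
        (fun L hL => hP (Or.inr ⟨L, hL, rfl⟩))
    · exact h.c1 r hr (fun s hs => hP ⟨s, hs, rfl⟩)
    · exact h.b1 r hr L hL (hN _ rfl) (hP rfl)
    · exact h.b2 r hr L hL (hP (Or.inl rfl)) (hP (Or.inr rfl))
    · exact h.c2 r hr s hs (hN _ rfl)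
    · exact h.c3 r hr s hs (hP (Or.inl rfl)) (hP (Or.inr rfl))
    · exact h.c4 r hr s hs (hP (Or.inl rfl)) (hP (Or.inr rfl))
    · exact h.t r hr s hs u hu (hP (Or.inl rfl)) (hP (Or.inr rfl))
    · exact h.as r hr s hs (hP rfl)

/-- A consistent answer set of a program without preference atoms has none either. -/
theorem answerSet.regLitO_of_mem {α N : Type} {P : Set (ORule α N)}
    (hreg : ∀ r ∈ P, noPref r) {X : Set (Lit (OAtom α N))} (hX : consistent X)
    (h : answerSet P X) {L : Lit (OAtom α N)} (hL : L ∈ X) : regLitO L := by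
  refine (h.subset_of_closedUnder hX (Z := {L ∈ X | regLitO L}) (Set.sep_subset _ _) ?_ hL).2
  have hc := closedUnder_reduct_iff.1 h.closedUnder_reduct
  rw [closedUnder_reduct_iff]
  exact fun r hr hN hP =>
    ⟨hc r hr hN (hP.trans (Set.sep_subset _ _)), hreg r hr _ (Set.mem_insert _ _)⟩

/-- The translation of a program without preference atoms derives no preference. -/
theorem tpref_notMem_of_answerSet_TTrans {α N : Type} {P : Set (ORule α N)}
    {nm : ORule α N → N} (hreg : ∀ r ∈ P, noPref r) {Y : Set (Lit (TAtom α N))}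
    (hY : consistent Y) (h : answerSet (TTrans P nm) Y) (n m : N) : tpref n m ∉ Y := by
  intro hmem
  refine (h.subset_of_closedUnder hY (Z := {L ∈ Y | ∀ n m, L ≠ tpref n m})
    (Set.sep_subset _ _) ?_ hmem).2 n m rfl
  have hc := closedUnder_reduct_TTrans_iff.1 h.closedUnder_reduct
  rw [closedUnder_reduct_TTrans_iff]
  constructor
  · rintro r hr ⟨h1, -⟩
    refine ⟨hc.a1 r hr h1, fun n m he => ?_⟩
    obtain ⟨a, ha⟩ := hreg r hr r.head (Set.mem_insert _ _)
    generalize r.head = L at he ha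
    cases L <;> simp_all [oldLit, Lit.map, tpref, Lit.atom]
  · exact fun r hr h1 h2 h3 => ⟨hc.a2 r hr h1 h2.1 fun L hL => (h3 L hL).1,
      by simp [apLit, tpref]⟩
  · exact fun r hr L hL h1 h2 => ⟨hc.b1 r hr L hL h1 h2.1, by simp [blLit, tpref]⟩
  · exact fun r hr L hL h1 h2 => ⟨hc.b2 r hr L hL h1.1 h2.1, by simp [blLit, tpref]⟩
  · exact fun r hr h1 => ⟨hc.c1 r hr fun s hs => (h1 s hs).1, by simp [okLit, tpref]⟩
  · exact fun r hr s hs h1 => ⟨hc.c2 r hr s hs h1, by simp [rdyLit, tpref]⟩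
  · exact fun r hr s hs h1 => (h1.2 _ _ rfl).elim
  · exact fun r hr s hs h1 => (h1.2 _ _ rfl).elim
  · exact fun r hr s hs u hu h1 => (h1.2 _ _ rfl).elim
  · exact fun r hr s hs h1 => (h1.2 _ _ rfl).elim

/-- The answer set of `𝒯(Π)` that corresponds to an answer set `X` of `Π`, for `Π` without
preferences. -/
def transAnswerSet {α N : Type} (P : Set (ORule α N)) (nm : ORule α N → N)
    (X : Set (Lit (OAtom α N))) : Set (Lit (TAtom α N)) :=
  oldLit '' X ∪ Set.range okLit ∪ Set.range (Function.uncurry rdyLit) ∪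
    (fun r => apLit (nm r)) '' GR P X ∪ (fun r => blLit (nm r)) '' (P \ GR P X)

section transAnswerSet

variable {α N : Type} {P : Set (ORule α N)} {nm : ORule α N → N} {X : Set (Lit (OAtom α N))}

theorem oldLit_mem_transAnswerSet {L : Lit (OAtom α N)} :
    oldLit L ∈ transAnswerSet P nm X ↔ L ∈ X := by
  cases L <;>
    simp [transAnswerSet, oldLit_injective.mem_set_image, okLit, rdyLit, apLit, blLit] <;>
    simp [oldLit, Lit.map]

theorem okLit_mem_transAnswerSet (n : N) : okLit n ∈ transAnswerSet P nm X := by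
  simp [transAnswerSet]

theorem rdyLit_mem_transAnswerSet (n m : N) : rdyLit n m ∈ transAnswerSet P nm X :=
  Or.inl (Or.inl (Or.inr ⟨(n, m), rfl⟩))

theorem apLit_mem_transAnswerSet (hnm : Set.InjOn nm P) {r : ORule α N} (hr : r ∈ P) :
    apLit (nm r) ∈ transAnswerSet P nm X ↔ r ∈ GR P X := by
  constructor
  · rintro ((((⟨_ | _, -, h⟩ | ⟨_, h⟩) | ⟨_, h⟩) | ⟨s, hs, h⟩) | ⟨s, hs, h⟩) <;>
      simp [oldLit, Lit.map, apLit, okLit, rdyLit, blLit, Function.uncurry] at h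
    rwa [← hnm hs.1 hr h]
  · exact fun h => Or.inl (Or.inr ⟨r, h, rfl⟩)

theorem blLit_mem_transAnswerSet {r : ORule α N} (hr : r ∈ P) (h : r ∉ GR P X) :
    blLit (nm r) ∈ transAnswerSet P nm X :=
  Or.inr ⟨r, ⟨hr, h⟩, rfl⟩

theorem neg_mem_transAnswerSet {a : TAtom α N}
    (h : Lit.neg a ∈ transAnswerSet P nm X) : ∃ b, a = TAtom.old b := by
  obtain ((((⟨L | L, -, h⟩ | ⟨_, h⟩) | ⟨_, h⟩) | ⟨s, hs, h⟩) | ⟨s, hs, h⟩) := h <;>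
    simp [oldLit, Lit.map, apLit, okLit, rdyLit, blLit, Function.uncurry] at h
  exact ⟨L, h.symm⟩

theorem consistent_transAnswerSet (hX : consistent X) :
    consistent (transAnswerSet P nm X) := by
  rintro ⟨a, hp, hn⟩
  obtain ⟨b, rfl⟩ := neg_mem_transAnswerSet hn
  exact hX ⟨b, oldLit_mem_transAnswerSet.1 hp, oldLit_mem_transAnswerSet.1 hn⟩

theorem tpref_notMem_transAnswerSet (hreg : ∀ r ∈ P, noPref r) (hX : consistent X)
    (h : answerSet P X) (n m : N) : tpref n m ∉ transAnswerSet P nm X := by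
  intro hmem
  obtain ⟨a, ha⟩ := h.regLitO_of_mem hreg hX
    (oldLit_mem_transAnswerSet (L := Lit.pos (OAtom.pref n m)).1 hmem)
  simp [Lit.atom] at ha

theorem TClosed_transAnswerSet (hnm : Set.InjOn nm P) (hreg : ∀ r ∈ P, noPref r)
    (hX : consistent X) (h : answerSet P X) :
    TClosed P nm (transAnswerSet P nm X) (transAnswerSet P nm X) := by
  have hc := closedUnder_reduct_iff.1 h.closedUnder_reduct
  have hpref := tpref_notMem_transAnswerSet (nm := nm) hreg hX h
  constructor
  · intro r hr h1
    obtain ⟨-, h2, h3⟩ := (apLit_mem_transAnswerSet hnm hr).1 h1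
    exact oldLit_mem_transAnswerSet.2 (hc r hr (fun L hL hLX => h3 ⟨L, hL, hLX⟩) h2)
  · intro r hr h1 _ h3
    exact (apLit_mem_transAnswerSet hnm hr).2
      ⟨hr, fun L hL => oldLit_mem_transAnswerSet.1 (h3 L hL),
        fun ⟨L, hL, hLX⟩ => h1 L hL (oldLit_mem_transAnswerSet.2 hLX)⟩
  · exact fun r hr L hL h1 _ => blLit_mem_transAnswerSet hr
      fun hG => h1 (oldLit_mem_transAnswerSet.2 (hG.2.1 hL))
  · exact fun r hr L hL _ h1 => blLit_mem_transAnswerSet hr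
      fun hG => hG.2.2 ⟨L, hL, oldLit_mem_transAnswerSet.1 h1⟩
  · exact fun r _ _ => okLit_mem_transAnswerSet _
  · exact fun r _ s _ _ => rdyLit_mem_transAnswerSet _ _
  · exact fun r _ s _ _ _ => rdyLit_mem_transAnswerSet _ _
  · exact fun r _ s _ _ _ => rdyLit_mem_transAnswerSet _ _
  · exact fun r _ s _ _ _ h1 => (hpref _ _ h1).elim
  · exact fun r _ s _ h1 => (hpref _ _ h1).elim

theorem answerSet_transAnswerSet (hnm : Set.BijOn nm P Set.univ)
    (hreg : ∀ r ∈ P, noPref r) (hX : consistent X) (h : answerSet P X) :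
    answerSet (TTrans P nm) (transAnswerSet P nm X) := by
  have hY := TClosed_transAnswerSet hnm.injOn hreg hX h
  refine (Th_subset (Or.inl (consistent_transAnswerSet hX))
    (closedUnder_reduct_TTrans_iff.2 hY)).antisymm ?_
  rintro L hL Z ⟨hZ, hc⟩
  rw [closedUnder_reduct_TTrans_iff] at hc
  have hsurj : ∀ n, ∃ r ∈ P, nm r = n := fun n => hnm.surjOn (Set.mem_univ n)
  have hpref := tpref_notMem_transAnswerSet (nm := nm) hreg hX h
  have hrdy : ∀ r ∈ P, ∀ s ∈ P, rdyLit (nm r) (nm s) ∈ Z :=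
    fun r hr s hs => hc.c2 r hr s hs (hpref _ _)
  have hok : ∀ r ∈ P, okLit (nm r) ∈ Z := fun r hr => hc.c1 r hr (hrdy r hr)
  have hold : X ⊆ oldLit ⁻¹' Z := by
    refine h.symm.subset.trans (Th_subset ?_ ?_)
    · refine hZ.imp (fun hZ => ?_) (fun hZ => by simp [hZ])
      rintro ⟨a, hp, hn⟩
      exact hZ ⟨_, hp, hn⟩
    · rw [closedUnder_reduct_iff]
      intro r hr hN hP
      exact hc.a1 r hr (hc.a2 r hr
        (fun L hL hLY => hN L hL (oldLit_mem_transAnswerSet.1 hLY)) (hok r hr) hP)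
  obtain ((((⟨K, hK, rfl⟩ | ⟨n, rfl⟩) | ⟨⟨n, m⟩, rfl⟩) | ⟨r, hr, rfl⟩) | ⟨r, hr, rfl⟩) := hL
  · exact hold hK
  · obtain ⟨r, hr, rfl⟩ := hsurj n
    exact hok r hr
  · obtain ⟨r, hr, rfl⟩ := hsurj n
    obtain ⟨s, hs, rfl⟩ := hsurj m
    exact hrdy r hr s hs
  · exact hc.a2 r hr.1
      (fun L hL hLY => hr.2.2 ⟨L, hL, oldLit_mem_transAnswerSet.1 hLY⟩) (hok r hr.1)
      (fun L hL => hold (hr.2.1 hL))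
  · obtain ⟨hrP, hrG⟩ := hr
    by_cases hb : r.bodyP ⊆ X
    · obtain ⟨L, hL, hLX⟩ : defeated r X := by
        by_contra hd
        exact hrG ⟨hrP, hb, hd⟩
      exact hc.b2 r hrP L hL (hok r hrP) (hold hLX)
    · obtain ⟨L, hL, hLX⟩ := Set.not_subset.1 hb
      exact hc.b1 r hrP L hL (fun hLY => hLX (oldLit_mem_transAnswerSet.1 hLY)) (hok r hrP)

end transAnswerSet

/-- The `𝓛`-part of a consistent answer set of `𝒯(Π)` is an answer set of `Π`, for `Π`
without preferences. -/
theorem answerSet_preimage_oldLit {α N : Type} {P : Set (ORule α N)} {nm : ORule α N → N}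
    (hnm : Set.InjOn nm P) (hreg : ∀ r ∈ P, noPref r) {Y : Set (Lit (TAtom α N))}
    (hY : consistent Y) (h : answerSet (TTrans P nm) Y) :
    answerSet P (oldLit ⁻¹' Y) := by
  have hpref := tpref_notMem_of_answerSet_TTrans hreg hY h
  have hc := closedUnder_reduct_TTrans_iff.1 h.closedUnder_reduct
  have hok : ∀ r ∈ P, okLit (nm r) ∈ Y :=
    fun r hr => hc.c1 r hr fun s hs => hc.c2 r hr s hs (hpref _ _)
  have hcX : closedUnder (reduct P (oldLit ⁻¹' Y)) (oldLit ⁻¹' Y) :=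
    closedUnder_reduct_iff.2 fun r hr hN hP => hc.a1 r hr (hc.a2 r hr hN (hok r hr) hP)
  have hX : consistent (oldLit ⁻¹' Y) := fun ⟨_, hp, hn⟩ => hY ⟨_, hp, hn⟩
  refine (Th_subset (Or.inl hX) hcX).antisymm ?_
  set V := Th (reduct P (oldLit ⁻¹' Y))
  have hVc := closedUnder_reduct_iff.1 (closedUnder_Th (reduct P (oldLit ⁻¹' Y)))
  have key : Y ⊆ {L ∈ Y | (∀ K, L = oldLit K → K ∈ V) ∧
      ∀ r ∈ P, L = apLit (nm r) → r.bodyP ⊆ V ∧ ∀ K ∈ r.bodyN, oldLit K ∉ Y} := by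
    refine h.subset_of_closedUnder hY (Set.sep_subset _ _) ?_
    have hne : ∀ (K : Lit (OAtom α N)) (n m : N), apLit n ≠ oldLit K ∧ blLit n ≠ oldLit K ∧
        okLit n ≠ oldLit K ∧ rdyLit n m ≠ oldLit K := by
      rintro (_ | _) n m <;> simp [apLit, blLit, okLit, rdyLit, oldLit, Lit.map]
    rw [closedUnder_reduct_TTrans_iff]
    constructor
    · rintro r hr ⟨h1, -, h2⟩
      obtain ⟨h3, h4⟩ := h2 r hr rfl
      refine ⟨hc.a1 r hr h1, fun K hK => ?_, fun s _ hs => ((hne _ _ (nm s)).1 hs.symm).elim⟩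
      rw [← oldLit_injective hK]
      exact hVc r hr h4 h3
    · intro r hr h1 h2 h3
      refine ⟨hc.a2 r hr h1 h2.1 fun L hL => (h3 L hL).1,
        fun K hK => ((hne _ _ (nm r)).1 hK).elim, fun s hs hrs => ?_⟩
      obtain rfl : r = s := hnm hr hs (by simpa [apLit] using hrs)
      exact ⟨fun L hL => (h3 L hL).2.1 L rfl, h1⟩
    · exact fun r hr L hL h1 h2 => ⟨hc.b1 r hr L hL h1 h2.1,
        fun K hK => ((hne _ _ (nm r)).2.1 hK).elim, by simp [blLit, apLit]⟩
    · exact fun r hr L hL h1 h2 => ⟨hc.b2 r hr L hL h1.1 h2.1,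
        fun K hK => ((hne _ _ (nm r)).2.1 hK).elim, by simp [blLit, apLit]⟩
    · exact fun r hr _ => ⟨hok r hr,
        fun K hK => ((hne _ _ (nm r)).2.2.1 hK).elim, by simp [okLit, apLit]⟩
    · exact fun r hr s hs h1 => ⟨hc.c2 r hr s hs h1,
        fun K hK => ((hne _ _ _).2.2.2 hK).elim, by simp [rdyLit, apLit]⟩
    · exact fun r _ s _ h1 => (hpref _ _ h1.1).elim
    · exact fun r _ s _ h1 => (hpref _ _ h1.1).elim
    · exact fun r _ s _ u _ h1 => (hpref _ _ h1.1).elim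
    · exact fun r _ s _ h1 => (hpref _ _ h1.1).elim
  exact fun L hL => (key hL).2.1 L rfl

theorem consistent_of_consistent_preimage_oldLit {α N : Type} {Y : Set (Lit (TAtom α N))}
    (hY : logClosed Y) (hX : consistent (oldLit ⁻¹' Y)) : consistent Y := by
  intro hinc
  obtain rfl : Y = Set.univ := hY.resolve_left fun hcons => hcons hinc
  obtain ⟨a, -⟩ := hinc
  have hall : ∀ o : OAtom α N, False := fun o => hX ⟨o, trivial, trivial⟩
  cases a with
  | old o => exact hall o
  | ap n => exact hall (OAtom.pref n n)
  | bl n => exact hall (OAtom.pref n n)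
  | ok n => exact hall (OAtom.pref n n)
  | rdy n m => exact hall (OAtom.pref n m)

theorem stmt13 {α N : Type} (P : Set (ORule α N)) (nm : ORule α N → N)
    (hfin : P.Finite) (hnm : Set.BijOn nm P Set.univ)
    (hreg : ∀ r ∈ P, noPref r)
    (X : Set (Lit (OAtom α N))) (hX : consistent X) :
    answerSet P X ↔
      ∃ Y, answerSet (TTrans P nm) Y ∧
        Lit.map TAtom.old '' X = Y ∩ oldLitsT := by
  constructor
  · intro h
    refine ⟨transAnswerSet P nm X, answerSet_transAnswerSet hnm hreg hX h, ?_⟩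
    ext L
    constructor
    · rintro ⟨K, hK, rfl⟩
      exact ⟨oldLit_mem_transAnswerSet.2 hK, K, rfl⟩
    · rintro ⟨hL, K, rfl⟩
      exact ⟨K, oldLit_mem_transAnswerSet.1 hL, rfl⟩
  · rintro ⟨Y, hY, hXY⟩
    obtain rfl : X = oldLit ⁻¹' Y := by
      ext L
      rw [← oldLit_injective.mem_set_image, show oldLit '' X = Y ∩ oldLitsT from hXY]
      exact ⟨fun h => h.1, fun h => ⟨h, L, rfl⟩⟩
    exact answerSet_preimage_oldLit hnm.injOn hreg
      (consistent_of_consistent_preimage_oldLit hY.logClosed hX) hY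

end ASP
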